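/- Let d ≥ 1, s > d/2 and n ≥ 1. Then there exists a constant C depending only on d, s and n such that for every v ∈ h^s and every k ∈ ℤ^d the series defining P_k(v, n) converges absolutely, the sequence P(v, n) = (P_k(v, n))_{k∈ℤ^d} belongs to h^s, and |P(v, n)|_s ≤ C |v|_s^{2n+1}. -/

import Mathlib

open scoped BigOperators

/-- `lam d k = |k|²`, the squared Euclidean norm of `k ∈ ℤ^d`. -/
def lam (d : ℕ) (k : Fin d → ℤ) : ℤ := ∑ i, (k i) ^ 2

/-- The weight `|k|^{2s} + 1 = (|k|²)^s + 1` in the definition of the `h^s` norm. -/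
noncomputable def wt (d : ℕ) (s : ℝ) (k : Fin d → ℤ) : ℝ := ((lam d k : ℝ)) ^ s + 1

/-- `v ∈ h^s`, i.e. the series defining `|v|_s²` converges. -/
def memH (d : ℕ) (s : ℝ) (v : (Fin d → ℤ) → ℂ) : Prop :=
  Summable fun k => wt d s k * ‖v k‖ ^ 2

/-- The norm `|v|_s` of `h^s`. -/
noncomputable def hnorm (d : ℕ) (s : ℝ) (v : (Fin d → ℤ) → ℂ) : ℝ :=
  Real.sqrt (∑' k, wt d s k * ‖v k‖ ^ 2)

/-- The summand of `P_k(v,n)`: the monomial `v_{k₁} conj(v_{k₂}) ⋯ v_{k_{2n+1}}` if the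
tuple `κ` lies in `S(k,n)` (i.e. the alternating sum of `κ` equals `k`), and `0` otherwise. -/
noncomputable def Pterm (d n : ℕ) (v : (Fin d → ℤ) → ℂ) (k : Fin d → ℤ)
    (κ : Fin (2 * n + 1) → (Fin d → ℤ)) : ℂ :=
  if (∑ j : Fin (2 * n + 1), ((-1 : ℤ) ^ (j : ℕ)) • κ j) = k then
    ∏ j : Fin (2 * n + 1), (if Even (j : ℕ) then v (κ j) else (starRingEnd ℂ) (v (κ j)))
  else 0

/-- `P_k(v,n) = Σ_{(k₁,…,k_{2n+1}) ∈ S(k,n)} v_{k₁} conj(v_{k₂}) ⋯ v_{k_{2n+1}}`. -/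
noncomputable def Pk (d n : ℕ) (v : (Fin d → ℤ) → ℂ) (k : Fin d → ℤ) : ℂ :=
  ∑' κ : Fin (2 * n + 1) → (Fin d → ℤ), Pterm d n v k κ

/-- The summand of `R_k(v,n)`: as `Pterm`, but restricted to resonant tuples. -/
noncomputable def Rterm (d n : ℕ) (v : (Fin d → ℤ) → ℂ) (k : Fin d → ℤ)
    (κ : Fin (2 * n + 1) → (Fin d → ℤ)) : ℂ :=
  if (∑ j : Fin (2 * n + 1), ((-1 : ℤ) ^ (j : ℕ)) • κ j) = k ∧
      (∑ j : Fin (2 * n + 1), ((-1 : ℤ) ^ (j : ℕ)) * lam d (κ j)) = lam d k then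
    ∏ j : Fin (2 * n + 1), (if Even (j : ℕ) then v (κ j) else (starRingEnd ℂ) (v (κ j)))
  else 0

/-- `R_k(v,n)`, the resonant part of `P_k(v,n)`. -/
noncomputable def Rk (d n : ℕ) (v : (Fin d → ℤ) → ℂ) (k : Fin d → ℤ) : ℂ :=
  ∑' κ : Fin (2 * n + 1) → (Fin d → ℤ), Rterm d n v k κ

open scoped ENNReal

namespace ENNReal

theorem sq_tsum_le_tsum_mul_tsum {ι : Type*} {f p q : ι → ℝ≥0∞} (h : ∀ i, f i ^ 2 ≤ p i * q i) :
    (∑' i, f i) ^ 2 ≤ (∑' i, p i) * ∑' i, q i := by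
  have sq_root (x : ℝ≥0∞) : (x ^ (1 / 2 : ℝ)) ^ (2 : ℝ) = x := by
    rw [← ENNReal.rpow_mul]; norm_num
  have le_root (i : ι) : f i ≤ p i ^ (1 / 2 : ℝ) * q i ^ (1 / 2 : ℝ) := by
    rw [← ENNReal.mul_rpow_of_nonneg _ _ (by norm_num), one_div,
      ENNReal.le_rpow_inv_iff two_pos, ENNReal.rpow_two]
    exact h i
  rw [ENNReal.tsum_eq_iSup_sum, ENNReal.iSup_pow]
  refine iSup_le fun t => ?_
  have holder := (Finset.sum_le_sum fun i (_ : i ∈ t) => le_root i).trans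
    (ENNReal.inner_le_Lp_mul_Lq t _ _ Real.HolderConjugate.two_two)
  simp only [sq_root] at holder
  calc (∑ i ∈ t, f i) ^ 2
      ≤ ((∑ i ∈ t, p i) ^ (1 / 2 : ℝ) * (∑ i ∈ t, q i) ^ (1 / 2 : ℝ)) ^ 2 := by gcongr
    _ = (∑ i ∈ t, p i) * ∑ i ∈ t, q i := by
      rw [mul_pow, ← ENNReal.rpow_two, ← ENNReal.rpow_two, sq_root, sq_root]
    _ ≤ _ := by gcongr <;> exact ENNReal.sum_le_tsum t

theorem tsum_fin_prod {G : Type*} (f : G → ℝ≥0∞) (m : ℕ) :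
    ∑' κ : Fin m → G, ∏ j, f (κ j) = (∑' a, f a) ^ m := by
  induction m with
  | zero => simp
  | succ m ih =>
    rw [← (Fin.consEquiv fun _ => G).tsum_eq, ENNReal.tsum_prod']
    simp only [Fin.consEquiv, Equiv.coe_fn_mk, Fin.prod_univ_succ, Fin.cons_zero, Fin.cons_succ]
    simp_rw [ENNReal.tsum_mul_left, ih, ENNReal.tsum_mul_right, pow_succ']

theorem tsum_weighted_sq_tsum_fiber_le {G : Type*} [DecidableEq G] {m : ℕ} {w : G → ℝ≥0∞}
    {C : ℝ≥0∞}
    (σ : (Fin (m + 1) → G) → G) (hw0 : ∀ a, w a ≠ 0) (hwt : ∀ a, w a ≠ ∞)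
    (hw : ∀ κ, w (σ κ) ≤ C * ∑ j, w (κ j))
    (hσ : ∀ j : Fin (m + 1), Function.Injective fun κ => (σ κ, j.removeNth κ)) (f : G → ℝ≥0∞) :
    ∑' k, w k * (∑' κ, if σ κ = k then ∏ j, f (κ j) else 0) ^ 2 ≤
      C * ((m + 1) * (∑' a, (w a)⁻¹) ^ m) * (∑' a, w a * f a ^ 2) ^ (m + 1) := by
  have cs (k : G) : (∑' κ, if σ κ = k then ∏ j, f (κ j) else 0) ^ 2 ≤
      (∑' κ, if σ κ = k then ∏ j, (w (κ j))⁻¹ else 0) *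
        ∑' κ, if σ κ = k then ∏ j, w (κ j) * f (κ j) ^ 2 else 0 := by
    refine sq_tsum_le_tsum_mul_tsum fun κ => ?_
    split_ifs
    · rw [← Finset.prod_mul_distrib, ← Finset.prod_pow]
      refine le_of_eq (Finset.prod_congr rfl fun j _ => ?_)
      rw [← mul_assoc, ENNReal.inv_mul_cancel (hw0 _) (hwt _), one_mul]
    · simp
  have fiber (j : Fin (m + 1)) (k : G) :
      (∑' κ, if σ κ = k then ∏ i, (w (κ (j.succAbove i)))⁻¹ else 0) ≤ (∑' a, (w a)⁻¹) ^ m := by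
    rw [← tsum_fin_prod]
    have hinj : Function.Injective fun κ : {κ // σ κ = k} => j.removeNth κ.1 := fun κ κ' h =>
      Subtype.ext (@hσ j κ.1 κ'.1 (Prod.ext (κ.2.trans κ'.2.symm) h))
    calc _ = ∑' κ : {κ // σ κ = k}, ∏ i, (w (j.removeNth κ.1 i))⁻¹ := by
          refine Eq.trans (tsum_congr fun κ => ?_)
            (tsum_subtype {κ | σ κ = k} fun κ => ∏ i, (w (j.removeNth κ i))⁻¹).symm
          simp [Set.indicator_apply, Fin.removeNth]
      _ ≤ _ := ENNReal.tsum_comp_le_tsum_of_injective hinj fun κ => ∏ i, (w (κ i))⁻¹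
  have weight (k : G) : w k * (∑' κ, if σ κ = k then ∏ j, (w (κ j))⁻¹ else 0) ≤
      C * ((m + 1) * (∑' a, (w a)⁻¹) ^ m) := by
    calc w k * (∑' κ, if σ κ = k then ∏ j, (w (κ j))⁻¹ else 0)
        = ∑' κ, w k * (if σ κ = k then ∏ j, (w (κ j))⁻¹ else 0) := ENNReal.tsum_mul_left.symm
      _ ≤ ∑' κ, C * ∑ j : Fin (m + 1),
            if σ κ = k then ∏ i, (w (κ (j.succAbove i)))⁻¹ else 0 := by
          refine ENNReal.tsum_le_tsum fun κ => ?_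
          split_ifs with h
          · subst h
            refine (mul_le_mul_left (hw κ) _).trans_eq ?_
            rw [mul_assoc, Finset.sum_mul]
            congr 1
            refine Finset.sum_congr rfl fun j _ => ?_
            rw [Fin.prod_univ_succAbove _ j, ← mul_assoc,
              ENNReal.mul_inv_cancel (hw0 _) (hwt _), one_mul]
          · simp
      _ = C * ∑ j : Fin (m + 1), ∑' κ,
            if σ κ = k then ∏ i, (w (κ (j.succAbove i)))⁻¹ else 0 := by
          rw [ENNReal.tsum_mul_left, Summable.tsum_finsetSum fun _ _ => ENNReal.summable]
      _ ≤ C * ∑ j : Fin (m + 1), (∑' a, (w a)⁻¹) ^ m := by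
          gcongr with j
          exact fiber j k
      _ = _ := by simp
  calc _ ≤ ∑' k, C * ((m + 1) * (∑' a, (w a)⁻¹) ^ m) *
        ∑' κ, if σ κ = k then ∏ j, w (κ j) * f (κ j) ^ 2 else 0 := by
        refine ENNReal.tsum_le_tsum fun k => ?_
        refine (mul_le_mul_right (cs k) _).trans ?_
        rw [← mul_assoc]
        exact mul_le_mul_left (weight k) _
    _ = _ := by
        rw [ENNReal.tsum_mul_left, ENNReal.tsum_comm]
        have collapse (κ : Fin (m + 1) → G) :
            (∑' k, if σ κ = k then ∏ j, w (κ j) * f (κ j) ^ 2 else 0) =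
              ∏ j, w (κ j) * f (κ j) ^ 2 := by
          simp_rw [eq_comm (a := σ κ)]
          exact tsum_ite_eq (σ κ) fun _ => ∏ j, w (κ j) * f (κ j) ^ 2
        simp_rw [collapse]
        rw [tsum_fin_prod fun a => w a * f a ^ 2]

end ENNReal

theorem lam_nonneg (d : ℕ) (k : Fin d → ℤ) : 0 ≤ lam d k :=
  Finset.sum_nonneg fun _ _ => sq_nonneg _

theorem one_le_wt (d : ℕ) (s : ℝ) (k : Fin d → ℤ) : 1 ≤ wt d s k :=
  le_add_of_nonneg_left (Real.rpow_nonneg (Int.cast_nonneg (lam_nonneg d k)) s)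

theorem wt_pos (d : ℕ) (s : ℝ) (k : Fin d → ℤ) : 0 < wt d s k :=
  zero_lt_one.trans_le (one_le_wt d s k)

theorem lam_alternating_sum_le (d m : ℕ) (κ : Fin (m + 1) → Fin d → ℤ) :
    lam d (∑ j : Fin (m + 1), (-1 : ℤ) ^ (j : ℕ) • κ j) ≤ (m + 1) * ∑ j, lam d (κ j) := by
  simp only [lam]
  rw [Finset.sum_comm, Finset.mul_sum]
  refine Finset.sum_le_sum fun i _ => ?_
  have h := sq_sum_le_card_mul_sum_sq (s := Finset.univ)
    (f := fun j : Fin (m + 1) => (-1 : ℤ) ^ (j : ℕ) * κ j i)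
  simpa [mul_pow, ← pow_mul, mul_comm _ 2] using h

theorem wt_alternating_sum_le (d m : ℕ) {s : ℝ} (hs : 0 ≤ s) (κ : Fin (m + 1) → Fin d → ℤ) :
    wt d s (∑ j : Fin (m + 1), (-1 : ℤ) ^ (j : ℕ) • κ j) ≤
      ((m + 1 : ℝ) ^ 2) ^ s * ∑ j, wt d s (κ j) := by
  obtain ⟨j, -, hj⟩ := Finset.exists_max_image Finset.univ (fun j => lam d (κ j))
    Finset.univ_nonempty
  have hlam : lam d (∑ j : Fin (m + 1), (-1 : ℤ) ^ (j : ℕ) • κ j) ≤ (m + 1) ^ 2 * lam d (κ j) := by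
    refine (lam_alternating_sum_le d m κ).trans ?_
    have hsum : ∑ i, lam d (κ i) ≤ (m + 1) * lam d (κ j) := by
      simpa using Finset.sum_le_card_nsmul Finset.univ _ _ hj
    nlinarith
  have hlamR : (lam d (∑ j : Fin (m + 1), (-1 : ℤ) ^ (j : ℕ) • κ j) : ℝ) ≤
      (m + 1) ^ 2 * (lam d (κ j) : ℝ) := by
    exact_mod_cast hlam
  have hc : 1 ≤ ((m + 1 : ℝ) ^ 2) ^ s :=
    Real.one_le_rpow (one_le_pow₀ (le_add_of_nonneg_left m.cast_nonneg)) hs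
  calc wt d s (∑ j : Fin (m + 1), (-1 : ℤ) ^ (j : ℕ) • κ j)
      ≤ ((m + 1 : ℝ) ^ 2 * lam d (κ j)) ^ s + 1 := by
        have := Real.rpow_le_rpow (Int.cast_nonneg (lam_nonneg _ _)) hlamR hs
        exact add_le_add_left this 1
    _ ≤ ((m + 1 : ℝ) ^ 2) ^ s * wt d s (κ j) := by
        rw [Real.mul_rpow (by positivity) (Int.cast_nonneg (lam_nonneg _ _)), wt, mul_add, mul_one]
        gcongr
    _ ≤ _ := by
        gcongr
        exact Finset.single_le_sum (f := fun j => wt d s (κ j)) (fun i _ => (wt_pos d s _).le)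
          (Finset.mem_univ j)

theorem prod_max_one_rpow_le_wt {d : ℕ} (hd : d ≠ 0) {s : ℝ} (hs : 0 ≤ s) (k : Fin d → ℤ) :
    ∏ i, (max 1 ((k i : ℝ) ^ 2)) ^ (s / d) ≤ wt d s k := by
  have hd' : (d : ℝ) ≠ 0 := Nat.cast_ne_zero.2 hd
  calc ∏ i, (max 1 ((k i : ℝ) ^ 2)) ^ (s / d)
      ≤ ∏ _i : Fin d, (max 1 (lam d k : ℝ)) ^ (s / d) := by
        refine Finset.prod_le_prod (fun i _ => by positivity) fun i _ => ?_
        gcongr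
        have := Finset.single_le_sum (f := fun i => k i ^ 2) (fun i _ => sq_nonneg _)
          (Finset.mem_univ i)
        exact_mod_cast this
    _ = (max 1 (lam d k : ℝ)) ^ s := by
        rw [Finset.prod_const, Finset.card_univ, Fintype.card_fin, ← Real.rpow_mul_natCast
          (by positivity), div_mul_cancel₀ s hd']
    _ ≤ wt d s k := by
        rcases le_total 1 (lam d k : ℝ) with h | h
        · rw [max_eq_right h, wt]
          exact le_add_of_nonneg_right zero_le_one
        · rw [max_eq_left h, Real.one_rpow]
          exact one_le_wt d s k

theorem summable_inv_max_one_sq_rpow {r : ℝ} (hr : 1 / 2 < r) :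
    Summable fun a : ℤ => ((max 1 ((a : ℝ) ^ 2)) ^ r)⁻¹ := by
  have hsum := Real.summable_abs_int_rpow (b := 2 * r) (by linarith)
  refine (hsum.add (hasSum_pi_single (0 : ℤ) (1 : ℝ)).summable).of_nonneg_of_le
    (fun a => by positivity) fun a => ?_
  rcases eq_or_ne a 0 with rfl | ha
  · simp; positivity
  · have h1 : (1 : ℝ) ≤ (a : ℝ) ^ 2 := by
      exact_mod_cast Int.add_one_le_iff.2 (by positivity : 0 < a ^ 2)
    rw [max_eq_right h1, Pi.single_eq_of_ne ha, add_zero, Real.rpow_neg (abs_nonneg _),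
      Real.rpow_mul (abs_nonneg _), Real.rpow_two, sq_abs]

theorem tsum_inv_wt_ne_top {d : ℕ} (hd : d ≠ 0) {s : ℝ} (hs : (d : ℝ) / 2 < s) :
    ∑' k, (ENNReal.ofReal (wt d s k))⁻¹ ≠ ∞ := by
  have hd' : (0 : ℝ) < d := Nat.cast_pos.2 (Nat.pos_of_ne_zero hd)
  have hr : 1 / 2 < s / d := by rw [lt_div_iff₀ hd']; linarith
  refine ne_top_of_le_ne_top (ENNReal.pow_ne_top (n := d)
    (summable_inv_max_one_sq_rpow hr).tsum_ofReal_ne_top) ?_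
  rw [← ENNReal.tsum_fin_prod]
  refine ENNReal.tsum_le_tsum fun k => ?_
  rw [← ENNReal.ofReal_prod_of_nonneg fun i _ => by positivity,
    ← ENNReal.ofReal_inv_of_pos (wt_pos d s k), Finset.prod_inv_distrib]
  refine ENNReal.ofReal_le_ofReal (inv_anti₀ (Finset.prod_pos fun i _ => by positivity) ?_)
  exact prod_max_one_rpow_le_wt hd (by linarith) k

theorem injective_alternating_sum_removeNth {G : Type*} [AddCommGroup G] {m : ℕ}
    (j : Fin (m + 1)) :
    Function.Injective fun κ : Fin (m + 1) → G =>
      (∑ i : Fin (m + 1), (-1 : ℤ) ^ (i : ℕ) • κ i, j.removeNth κ) := by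
  intro κ κ' h
  obtain ⟨hsum, hrest⟩ := Prod.mk.inj h
  have hrest' (i : Fin m) : κ (j.succAbove i) = κ' (j.succAbove i) := congrFun hrest i
  simp only [Fin.sum_univ_succAbove _ j, hrest', add_left_inj] at hsum
  have hj : κ j = κ' j := by
    rcases neg_one_pow_eq_or ℤ (j : ℕ) with h | h <;> simpa [h] using hsum
  funext i
  rcases Fin.eq_self_or_eq_succAbove j i with rfl | ⟨i, rfl⟩
  exacts [hj, hrest' i]

theorem enorm_Pterm (d n : ℕ) (v : (Fin d → ℤ) → ℂ) (k : Fin d → ℤ)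
    (κ : Fin (2 * n + 1) → Fin d → ℤ) :
    ‖Pterm d n v k κ‖ₑ =
      if ∑ j : Fin (2 * n + 1), (-1 : ℤ) ^ (j : ℕ) • κ j = k then ∏ j, ‖v (κ j)‖ₑ else 0 := by
  unfold Pterm
  split_ifs
  · rw [enorm_eq_nnnorm, nnnorm_prod, ENNReal.ofNNReal_finsetProd]
    simp_rw [← enorm_eq_nnnorm]
    refine Finset.prod_congr rfl fun j _ => ?_
    split_ifs <;> simp
  · simp

theorem ofReal_wt_mul_norm_sq (d : ℕ) (s : ℝ) (v : (Fin d → ℤ) → ℂ) (k : Fin d → ℤ) :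
    ENNReal.ofReal (wt d s k * ‖v k‖ ^ 2) = ENNReal.ofReal (wt d s k) * ‖v k‖ₑ ^ 2 := by
  rw [ENNReal.ofReal_mul (wt_pos d s k).le, ENNReal.ofReal_pow (norm_nonneg _), ofReal_norm]

theorem memH_iff_tsum_ne_top {d : ℕ} {s : ℝ} {v : (Fin d → ℤ) → ℂ} :
    memH d s v ↔ ∑' k, ENNReal.ofReal (wt d s k) * ‖v k‖ₑ ^ 2 ≠ ∞ := by
  have hnn (k) : 0 ≤ wt d s k * ‖v k‖ ^ 2 := mul_nonneg (wt_pos d s k).le (sq_nonneg _)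
  simp_rw [← ofReal_wt_mul_norm_sq]
  refine ⟨fun h => h.tsum_ofReal_ne_top, fun h => ?_⟩
  exact (ENNReal.summable_toReal h).congr fun k => ENNReal.toReal_ofReal (hnn k)

theorem hnorm_sq (d : ℕ) (s : ℝ) (v : (Fin d → ℤ) → ℂ) :
    hnorm d s v ^ 2 = (∑' k, ENNReal.ofReal (wt d s k) * ‖v k‖ₑ ^ 2).toReal := by
  have hnn (k) : 0 ≤ wt d s k * ‖v k‖ ^ 2 := mul_nonneg (wt_pos d s k).le (sq_nonneg _)
  simp_rw [hnorm, Real.sq_sqrt (tsum_nonneg hnn), ← ofReal_wt_mul_norm_sq]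
  rw [ENNReal.tsum_toReal_eq fun _ => ENNReal.ofReal_ne_top]
  exact tsum_congr fun k => (ENNReal.toReal_ofReal (hnn k)).symm

theorem exists_tsum_wt_mul_sq_tsum_Pterm_le {d n : ℕ} (hd : d ≠ 0) {s : ℝ}
    (hs : (d : ℝ) / 2 < s) :
    ∃ A : ℝ≥0∞, A ≠ ∞ ∧ ∀ v : (Fin d → ℤ) → ℂ,
      ∑' k, ENNReal.ofReal (wt d s k) * (∑' κ, ‖Pterm d n v k κ‖ₑ) ^ 2 ≤
        A * (∑' k, ENNReal.ofReal (wt d s k) * ‖v k‖ₑ ^ 2) ^ (2 * n + 1) := by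
  have hs0 : 0 ≤ s := le_trans (by positivity) hs.le
  have hw (κ : Fin (2 * n + 1) → Fin d → ℤ) :
      ENNReal.ofReal (wt d s (∑ j : Fin (2 * n + 1), (-1 : ℤ) ^ (j : ℕ) • κ j)) ≤
        ENNReal.ofReal ((((2 * n : ℕ) + 1 : ℝ) ^ 2) ^ s) * ∑ j, ENNReal.ofReal (wt d s (κ j)) := by
    rw [← ENNReal.ofReal_sum_of_nonneg fun j _ => (wt_pos d s _).le,
      ← ENNReal.ofReal_mul (by positivity)]
    exact ENNReal.ofReal_le_ofReal (wt_alternating_sum_le d (2 * n) hs0 κ)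
  have hK := tsum_inv_wt_ne_top hd hs
  refine ⟨ENNReal.ofReal ((((2 * n : ℕ) + 1 : ℝ) ^ 2) ^ s) * (((2 * n : ℕ) + 1) *
    (∑' k, (ENNReal.ofReal (wt d s k))⁻¹) ^ (2 * n)), by finiteness, fun v => ?_⟩
  simp_rw [enorm_Pterm]
  exact ENNReal.tsum_weighted_sq_tsum_fiber_le _
    (fun k => (ENNReal.ofReal_pos.2 (wt_pos d s k)).ne') (fun _ => ENNReal.ofReal_ne_top) hw
    injective_alternating_sum_removeNth _

/-- For `d ≥ 1`, `s > d/2`, `n ≥ 1` there is `C = C(d,s,n)` such that for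
every `v ∈ h^s` and every `k ∈ ℤ^d` the series defining `P_k(v,n)` converges absolutely,
`P(v,n) = (P_k(v,n))_k ∈ h^s`, and `|P(v,n)|_s ≤ C |v|_s^{2n+1}`. -/
theorem P_maps_hs_to_hs (d n : ℕ) (hd : 1 ≤ d) (hn : 1 ≤ n) (s : ℝ)
    (hs : (d : ℝ) / 2 < s) :
    ∃ C : ℝ, 0 < C ∧ ∀ v : (Fin d → ℤ) → ℂ, memH d s v →
      (∀ k : Fin d → ℤ, Summable fun κ => ‖Pterm d n v k κ‖) ∧
      memH d s (fun k => Pk d n v k) ∧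
      hnorm d s (fun k => Pk d n v k) ≤ C * hnorm d s v ^ (2 * n + 1) := by
  obtain ⟨A, hA, hbound⟩ := exists_tsum_wt_mul_sq_tsum_Pterm_le (n := n)
    (Nat.one_le_iff_ne_zero.1 hd) hs
  refine ⟨√A.toReal + 1, by positivity, fun v hv => ?_⟩
  have htop : A * (∑' k, ENNReal.ofReal (wt d s k) * ‖v k‖ₑ ^ 2) ^ (2 * n + 1) ≠ ∞ :=
    ENNReal.mul_ne_top hA (ENNReal.pow_ne_top (memH_iff_tsum_ne_top.1 hv))
  have hP : ∑' k, ENNReal.ofReal (wt d s k) * ‖Pk d n v k‖ₑ ^ 2 ≤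
      A * (∑' k, ENNReal.ofReal (wt d s k) * ‖v k‖ₑ ^ 2) ^ (2 * n + 1) := by
    refine le_trans (ENNReal.tsum_le_tsum fun k => ?_) (hbound v)
    gcongr
    exact enorm_tsum_le_tsum_enorm
  refine ⟨fun k => ?_, memH_iff_tsum_ne_top.2 (ne_top_of_le_ne_top htop hP), ?_⟩
  · have hk := ENNReal.ne_top_of_tsum_ne_top (ne_top_of_le_ne_top htop (hbound v)) k
    have hsum : ∑' κ, ‖Pterm d n v k κ‖ₑ ≠ ∞ := fun h => hk <| by
      rw [h, ENNReal.top_pow two_ne_zero,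
        ENNReal.mul_top (ENNReal.ofReal_pos.2 (wt_pos d s k)).ne']
    simpa using ENNReal.summable_toReal hsum
  · have hnn : 0 ≤ hnorm d s v := Real.sqrt_nonneg _
    have hsq : hnorm d s (fun k => Pk d n v k) ^ 2 ≤
        (√A.toReal * hnorm d s v ^ (2 * n + 1)) ^ 2 := by
      rw [mul_pow, Real.sq_sqrt ENNReal.toReal_nonneg, ← pow_mul, mul_comm _ 2, pow_mul,
        hnorm_sq, hnorm_sq, ← ENNReal.toReal_pow, ← ENNReal.toReal_mul]
      exact ENNReal.toReal_mono htop hP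
    refine (le_of_sq_le_sq hsq (by positivity)).trans ?_
    gcongr
    exact le_add_of_nonneg_right zero_le_one
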